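/- Let s ≥ 2 and let P_m be a dyadic digital (t_m, m, s)-net in base 2 with t_m ≤ (1/10)·log₂ m. Let J = (J_1, J_2, J_3) be the partition of {1,…,s} with J_1 = {1,…,s}, J_2 = J_3 = ∅ (so d_1 = s, d_2 = d_3 = 0). Then ∑_{k_1, k_2 = 1}^m |Υ_{s,0,0,J,(k_1,k_2)}| ≪ m^{2(s−1) − 2/5}, where the implied constant depends only on s. -/

import Mathlib

open MeasureTheory Filter

noncomputable section

attribute [local instance] Classical.propDecidable

/-- The `a`-th binary digit (`a ≥ 1`) of the dyadic expansion of `x ∈ [0,1)`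
(the finite expansion is used for dyadic rationals). -/
def bdigit (a : ℕ) (x : ℝ) : ℕ := (⌊x * 2 ^ a⌋).toNat % 2

/-- Digitwise addition modulo 2 of dyadic expansions: `x ⊕ y`. -/
def xorReal (x y : ℝ) : ℝ :=
  ∑' a : ℕ, (((bdigit (a + 1) x + bdigit (a + 1) y) % 2 : ℕ) : ℝ) / 2 ^ (a + 1)

/-- Coordinatewise digitwise addition `⊕` on vectors. -/
def xorVec {s : ℕ} (X Y : Fin s → ℝ) : Fin s → ℝ := fun i => xorReal (X i) (Y i)

/-- Local discrepancy `D(P, Y)` of a finite point set `P` in `[0,1)^s`. -/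
def Dloc {N s : ℕ} (P : Fin N → Fin s → ℝ) (Y : Fin s → ℝ) : ℝ :=
  (∑ n : Fin N, if ∀ i, 0 ≤ P n i ∧ P n i < Y i then (1 : ℝ) else 0) -
    (N : ℝ) * ∏ i, Y i

/-- `P` is a `(t,m,s)`-net in base 2: every elementary dyadic box of volume
`2^(t-m)` contains exactly `2^t` of the points. -/
def IsNet (t m s : ℕ) (P : Fin (2 ^ m) → Fin s → ℝ) : Prop :=
  ∀ d a : Fin s → ℕ, (∀ i, a i < 2 ^ d i) → (∑ i, d i) + t = m →
    (Finset.univ.filter fun n => ∀ i,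
        (a i : ℝ) / 2 ^ d i ≤ P n i ∧ P n i < ((a i : ℝ) + 1) / 2 ^ d i).card = 2 ^ t

/-- The digits `x_{n,i,j}` of the `n`-th point of the dyadic digital net with
generating matrices `C`. -/
def netDig (m s : ℕ) (C : Fin s → Matrix (Fin m) (Fin m) (ZMod 2)) (n : ℕ) :
    Fin s → Fin m → ZMod 2 :=
  fun i j => ∑ r : Fin m, C i j r * (if n.testBit r then 1 else 0)

/-- The `n`-th point of the dyadic digital net with generating matrices `C`. -/
def netPoint (m s : ℕ) (C : Fin s → Matrix (Fin m) (Fin m) (ZMod 2)) (n : ℕ) :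
    Fin s → ℝ :=
  fun i => ∑ j : Fin m, ((netDig m s C n i j).val : ℝ) / 2 ^ ((j : ℕ) + 1)

/-- The unit cube `[0,1]^s`. -/
def cube (s : ℕ) : Set (Fin s → ℝ) := Set.univ.pi fun _ => Set.Icc (0 : ℝ) 1

/-- The point of `Q^s(2^m)` with coordinates `T i / 2^m`. -/
def Qpt {s : ℕ} (m : ℕ) (T : Fin s → Fin (2 ^ m)) : Fin s → ℝ :=
  fun i => ((T i : ℕ) : ℝ) / 2 ^ m

/-- `M_{s,p}(P) = (2^{-sm} ∑_{T ∈ Q^s(2^m)} ∫_{[0,1]^s} |D(P ⊕ T, Y)|^p dY)^{1/p}`. -/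
def Msp (s m : ℕ) (p : ℝ) {N : ℕ} (P : Fin N → Fin s → ℝ) : ℝ :=
  ((2 : ℝ) ^ (-(s * m : ℤ)) * ∑ T : Fin s → Fin (2 ^ m),
      ∫ Y in cube s, |Dloc (fun n => xorVec (P n) (Qpt m T)) Y| ^ p) ^ (1 / p)

/-- The standard normal distribution function `Φ`. -/
def PhiCDF (w : ℝ) : ℝ :=
  (Real.sqrt (2 * Real.pi))⁻¹ * ∫ u in Set.Iio w, Real.exp (-u ^ 2 / 2)

/-- `χ_p`, the `p`-th absolute moment of the standard Gaussian. -/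
def chiMoment (p : ℝ) : ℝ :=
  (Real.sqrt (2 * Real.pi))⁻¹ * ∫ u : ℝ, |u| ^ p * Real.exp (-u ^ 2 / 2)

/-- Digits `y_{n,i,j}` of the points of the dyadic digital sequence generated by
the `ℕ × ℕ` matrices `C` over `F_2`. -/
def seqDig (s : ℕ) (C : Fin s → ℕ → ℕ → ZMod 2) (n : ℕ) : Fin s → ℕ → ZMod 2 :=
  fun i j => ∑ r ∈ Finset.range (n + 1), C i j r * (if n.testBit r then 1 else 0)

/-- The `n`-th point of the dyadic digital sequence generated by `C`. -/
def seqPoint (s : ℕ) (C : Fin s → ℕ → ℕ → ZMod 2) (n : ℕ) : Fin s → ℝ :=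
  fun i => ∑' j : ℕ, ((seqDig s C n i j).val : ℝ) / 2 ^ (j + 1)

/-- The digital sequence generated by `C` is a dyadic digital `(T,s)`-sequence:
for all `m ≥ 1` and `k ≥ 0` the block `X_{k2^m}, …, X_{k2^m+2^m-1}` is a
`(T(m),m,s)`-net in base 2. -/
def IsTSeq (s : ℕ) (Tf : ℕ → ℕ) (C : Fin s → ℕ → ℕ → ZMod 2) : Prop :=
  (∀ m, Tf m ≤ m) ∧
  ∀ m, 1 ≤ m → ∀ k : ℕ,
    IsNet (Tf m) m s fun n : Fin (2 ^ m) => seqPoint s C (k * 2 ^ m + (n : ℕ))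

/-- The dual net `P_m^⊥` of the digital net generated by `C`. -/
def dualNet (m s : ℕ) (C : Fin s → Matrix (Fin m) (Fin m) (ZMod 2)) :
    Finset (Fin s → Fin m → ZMod 2) :=
  Finset.univ.filter fun mm => ∀ n : Fin (2 ^ m),
    (∑ i, ∑ j, mm i j * netDig m s C (n : ℕ) i j) = 0

/-- `ρ(b)`: the position of the last nonzero digit (`ρ(0) = 0`). -/
def rhoF {m : ℕ} (b : Fin m → ZMod 2) : ℕ :=
  (Finset.univ.filter fun j => b j ≠ 0).sup fun j => (j : ℕ) + 1

/-- The 1-indexed component `𝔪_{i,a}` (as `0` or `1`), with the convention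
`𝔪_{i,0} = 0`. -/
def mAt {m : ℕ} (b : Fin m → ZMod 2) (a : ℕ) : ℕ :=
  if h : 1 ≤ a ∧ a ≤ m then (b ⟨a - 1, by omega⟩).val else 0

/-- The 1-indexed digit of a digit array, with the convention that digit `0`
and digits beyond `m` are `0`. -/
def dAt {m : ℕ} (y : Fin m → Fin 2) (a : ℕ) : ℕ :=
  if h : 1 ≤ a ∧ a ≤ m then (y ⟨a - 1, by omega⟩).val else 0

/-- `κ(A)`: the number of nonzero entries of `A`. -/
def kapF {s : ℕ} (A : Fin s → ℕ) : ℕ := (Finset.univ.filter fun i => A i ≠ 0).card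

/-- `a₀(A) = a₁ + ⋯ + a_s`. -/
def a0F {s : ℕ} (A : Fin s → ℕ) : ℕ := ∑ i, A i

/-- `Λ_A(T ⊕ Y^{(m)})` as a function of the digit arrays `t`, `y` of `T`, `Y`:
`∑_{𝔪 ∈ P^{⊥,*}, ρ(𝔪_i) ≤ a_i} e(∑_i (∑_j 𝔪_{i,j}(t_{i,j}+y_{i,j}) + 𝔪_{i,a_i}))`,
where `e(n) = exp(πin) = (-1)^n`. -/
def LamF (m s : ℕ) (C : Fin s → Matrix (Fin m) (Fin m) (ZMod 2)) (A : Fin s → ℕ)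
    (t y : Fin s → Fin m → Fin 2) : ℝ :=
  ∑ mm ∈ (dualNet m s C).filter fun mm => mm ≠ 0 ∧ ∀ i, rhoF (mm i) ≤ A i,
    (-1 : ℝ) ^
      (∑ i, ((∑ j, (mm i j).val * ((t i j : ℕ) + (y i j : ℕ))) + mAt (mm i) (A i)))

/-- The Rademacher function `r_A(Y)` as a function of the digit array of `Y`. -/
def rademF {m s : ℕ} (A : Fin s → ℕ) (y : Fin s → Fin m → Fin 2) : ℝ :=
  ∏ i, (-1 : ℝ) ^ dAt (y i) (A i)

/-- `Ψ_A = (-1)^{κ(A)} 2^{m-s-a₀(A)} r_A(Y) Λ_A(T ⊕ Y^{(m)})` at digit level. -/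
def PsiF (m s : ℕ) (C : Fin s → Matrix (Fin m) (Fin m) (ZMod 2)) (A : Fin s → ℕ)
    (t y : Fin s → Fin m → Fin 2) : ℝ :=
  (-1 : ℝ) ^ kapF A * (2 : ℝ) ^ ((m : ℤ) - (s : ℤ) - (a0F A : ℤ)) *
    rademF A y * LamF m s C A t y

/-- `V₀ = 10 log₂ m`. -/
def V0 (m : ℕ) : ℝ := 10 * Real.logb 2 m

/-- `I_{m,s,k} = {A ∈ I_m^s : max_i a_i = k, a₀(A) ∈ (m - t_m, m + V₀)}`. -/
def IndexSet (m s tm k : ℕ) : Finset (Fin s → ℕ) :=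
  (Fintype.piFinset fun _ : Fin s => Finset.range (m + 1)).filter fun A =>
    Finset.univ.sup A = k ∧ ((m : ℝ) - tm < a0F A ∧ (a0F A : ℝ) < m + V0 m)

/-- `I_{m,s,m+1} = {A ∈ I_m^s : a₀(A) ≥ m + V₀}`. -/
def IndexTail (m s : ℕ) : Finset (Fin s → ℕ) :=
  (Fintype.piFinset fun _ : Fin s => Finset.range (m + 1)).filter fun A =>
    (m : ℝ) + V0 m ≤ (a0F A : ℝ)

/-- `𝔇_k(T,Y) = ∑_{A ∈ I_{m,s,k}} Ψ_A` at digit level. -/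
def DDk (m s tm : ℕ) (C : Fin s → Matrix (Fin m) (Fin m) (ZMod 2)) (k : ℕ)
    (t y : Fin s → Fin m → Fin 2) : ℝ :=
  ∑ A ∈ IndexSet m s tm k, PsiF m s C A t y

/-- `R(T,Y) = ∑_{A ∈ I_{m,s,m+1}} Ψ_A` at digit level. -/
def Rtail (m s : ℕ) (C : Fin s → Matrix (Fin m) (Fin m) (ZMod 2))
    (t y : Fin s → Fin m → Fin 2) : ℝ :=
  ∑ A ∈ IndexTail m s, PsiF m s C A t y

/-- `E^{(m)}_{Y,T}(f)`: the average of `f` over all digit arrays. -/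
def Em (m s : ℕ) (f : (Fin s → Fin m → Fin 2) → (Fin s → Fin m → Fin 2) → ℝ) : ℝ :=
  (2 : ℝ) ^ (-(2 * s * m : ℤ)) *
    ∑ t : Fin s → Fin m → Fin 2, ∑ y : Fin s → Fin m → Fin 2, f t y

/-- Keep the first `k` digits of `t`, replace the remaining ones by those of `t'`. -/
def mergeDig {m s : ℕ} (k : ℕ) (t t' : Fin s → Fin m → Fin 2) :
    Fin s → Fin m → Fin 2 :=
  fun i j => if (j : ℕ) < k then t i j else t' i j

/-- The conditional expectation `E^{(m)}_{Y,T}(f | F_k)` with respect to the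
σ-field `F_k` generated by the dyadic cubes of side `2^{-k}`: the average of `f`
over the digits of index `> k`, as a function of the digit arrays `t`, `y`. -/
def EmCond (m s k : ℕ)
    (f : (Fin s → Fin m → Fin 2) → (Fin s → Fin m → Fin 2) → ℝ)
    (t y : Fin s → Fin m → Fin 2) : ℝ :=
  (2 : ℝ) ^ (-(2 * s * m : ℤ)) *
    ∑ t' : Fin s → Fin m → Fin 2, ∑ y' : Fin s → Fin m → Fin 2,
      f (mergeDig k t t') (mergeDig k y y')

/-- `Θ_{A₁,A₂,k} = E^{(m)}_{Y,T}(Ψ_{A₁}Ψ_{A₂} | F_{k-1}) - E^{(m)}_{Y,T}(Ψ_{A₁}Ψ_{A₂})`. -/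
def ThetaF (m s : ℕ) (C : Fin s → Matrix (Fin m) (Fin m) (ZMod 2))
    (A1 A2 : Fin s → ℕ) (k : ℕ) (t y : Fin s → Fin m → Fin 2) : ℝ :=
  EmCond m s (k - 1) (fun t' y' => PsiF m s C A1 t' y' * PsiF m s C A2 t' y') t y -
    Em m s fun t' y' => PsiF m s C A1 t' y' * PsiF m s C A2 t' y'

/-- `Υ_{d₁,d₂,d₃,J,k}` for a partition `J = (J₁,J₂,J₃)` of `{1,…,s}` and
`k = (k₁,k₂)`. -/
def Ups (m s tm : ℕ) (C : Fin s → Matrix (Fin m) (Fin m) (ZMod 2))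
    (J1 J2 J3 : Finset (Fin s)) (k1 k2 : ℕ) : ℝ :=
  ∑ A1 ∈ IndexSet m s tm k1, ∑ A2 ∈ IndexSet m s tm k1,
    ∑ A3 ∈ IndexSet m s tm k2, ∑ A4 ∈ IndexSet m s tm k2,
      (Em m s fun t y => ThetaF m s C A1 A2 k1 t y * ThetaF m s C A3 A4 k2 t y) *
        (if (Finset.univ.filter fun i => A1 i = A2 i) = J1 ∧
            (Finset.univ.filter fun i => A1 i < A2 i) = J2 ∧
            (Finset.univ.filter fun i => A2 i < A1 i) = J3 ∧
            (Finset.univ.filter fun i => A3 i = A4 i) = J1 ∧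
            (Finset.univ.filter fun i => A3 i < A4 i) = J2 ∧
            (Finset.univ.filter fun i => A4 i < A3 i) = J3 then (1 : ℝ) else 0)

/-- The array of the first `m` dyadic digits of the coordinates of `Y`. -/
def digitsOf (m s : ℕ) (Y : Fin s → ℝ) : Fin s → Fin m → Fin 2 :=
  fun i j => ⟨bdigit ((j : ℕ) + 1) (Y i), by unfold bdigit; omega⟩

/-- Truncation `y^{(m)}` to the first `m` dyadic digits. -/
def truncR (m : ℕ) (y : ℝ) : ℝ :=
  ∑ j ∈ Finset.range m, (bdigit (j + 1) y : ℝ) / 2 ^ (j + 1)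

/-- The elementary interval `Π_a` (`Π_0 = [0,1)`, `Π_a = [2^{-a}, 2^{1-a})`). -/
def PiBox (a : ℕ) : Set ℝ :=
  if a = 0 then Set.Ico 0 1 else Set.Ico ((2 : ℝ) ^ (-(a : ℤ))) ((2 : ℝ) ^ (1 - (a : ℤ)))

/-- `λ_A(Y) = 1_{Π_A}(Y) - vol(Π_A)`. -/
def lamA {s : ℕ} (A : Fin s → ℕ) (Y : Fin s → ℝ) : ℝ :=
  (if ∀ i, Y i ∈ PiBox (A i) then (1 : ℝ) else 0) - (2 : ℝ) ^ (-(a0F A : ℤ))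

/-- The micro-local discrepancy `λ_A(P_m^{(m)} ⊕ T ⊕ Y^{(m)})`. -/
def lamNet (m s : ℕ) (C : Fin s → Matrix (Fin m) (Fin m) (ZMod 2))
    (T Y : Fin s → ℝ) (A : Fin s → ℕ) : ℝ :=
  ∑ n : Fin (2 ^ m),
    lamA A fun i =>
      xorReal (xorReal (truncR m (netPoint m s C (n : ℕ) i)) (T i)) (truncR m (Y i))

/-- The Rademacher function `r_A(Y)` for a real point `Y`. -/
def rademReal {s : ℕ} (A : Fin s → ℕ) (Y : Fin s → ℝ) : ℝ :=
  ∏ i, if A i = 0 then (1 : ℝ) else 1 - 2 * (bdigit (A i) (Y i) : ℝ)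

/-- The truncated discrepancy
`D^{(m)}(P_m ⊕ T, Y) = 2^{-s} ∑_{A ∈ I_m^s} (-1)^{κ(A)} λ_A(P_m^{(m)} ⊕ T ⊕ Y^{(m)}) r_A(Y)`. -/
def Dm (m s : ℕ) (C : Fin s → Matrix (Fin m) (Fin m) (ZMod 2)) (T Y : Fin s → ℝ) : ℝ :=
  (2 : ℝ) ^ (-(s : ℤ)) *
    ∑ A ∈ Fintype.piFinset fun _ : Fin s => Finset.range (m + 1),
      (-1 : ℝ) ^ kapF A * lamNet m s C T Y A * rademReal A Y

/-- `𝔼_{Y,T,m}(f) = 2^{-sm} ∑_{T ∈ Q^s(2^m)} ∫_{[0,1]^s} f(T,Y) dY`. -/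
def EE (m s : ℕ) (f : (Fin s → ℝ) → (Fin s → ℝ) → ℝ) : ℝ :=
  (2 : ℝ) ^ (-(s * m : ℤ)) * ∑ T : Fin s → Fin (2 ^ m), ∫ Y in cube s, f (Qpt m T) Y

section Walsh

variable {m s : ℕ}

/-- The Walsh character of a single digit array. -/
def walshOne (n : Fin s → Fin m → ZMod 2) (t : Fin s → Fin m → Fin 2) : ℝ :=
  ∏ i, ∏ j, (-1 : ℝ) ^ ((n i j).val * (t i j : ℕ))

/-- The Walsh character `(t, y) ↦ (-1) ^ ⟨n, t + y⟩`. -/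
def walsh (n : Fin s → Fin m → ZMod 2) (t y : Fin s → Fin m → Fin 2) : ℝ :=
  walshOne n t * walshOne n y

lemma walsh_eq_pow (n : Fin s → Fin m → ZMod 2) (t y : Fin s → Fin m → Fin 2) :
    walsh n t y = (-1 : ℝ) ^ (∑ i, ∑ j, (n i j).val * ((t i j : ℕ) + (y i j : ℕ))) := by
  simp only [walsh, walshOne, mul_add, Finset.sum_add_distrib, pow_add,
    Finset.prod_pow_eq_pow_sum]

lemma neg_one_pow_val_add (a b : ZMod 2) :
    (-1 : ℝ) ^ (a + b).val = (-1) ^ a.val * (-1) ^ b.val := by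
  rw [ZMod.val_add, ← neg_one_pow_eq_pow_mod_two, pow_add]

lemma walshOne_add (n n' : Fin s → Fin m → ZMod 2) (t : Fin s → Fin m → Fin 2) :
    walshOne (n + n') t = walshOne n t * walshOne n' t := by
  simp only [walshOne, ← Finset.prod_mul_distrib, Pi.add_apply, pow_mul, neg_one_pow_val_add,
    mul_pow]

lemma walsh_add (n n' : Fin s → Fin m → ZMod 2) (t y : Fin s → Fin m → Fin 2) :
    walsh (n + n') t y = walsh n t y * walsh n' t y := by
  simp only [walsh, walshOne_add]; ring

lemma sum_walshOne_mergeDig (k : ℕ) (n : Fin s → Fin m → ZMod 2) (t : Fin s → Fin m → Fin 2) :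
    ∑ t', walshOne n (mergeDig k t t') =
      (2 : ℝ) ^ (s * m) * (if ∀ i, ∀ j : Fin m, k ≤ (j : ℕ) → n i j = 0 then walshOne n t else 0) := by
  by_cases h : ∀ i, ∀ j : Fin m, k ≤ (j : ℕ) → n i j = 0
  · rw [if_pos h]
    have key : ∀ t', walshOne n (mergeDig k t t') = walshOne n t := by
      intro t'
      refine Finset.prod_congr rfl fun i _ => Finset.prod_congr rfl fun j _ => ?_
      by_cases hj : (j : ℕ) < k
      · simp [mergeDig, hj]
      · simp [h i j (not_lt.mp hj)]
    simp only [key, Finset.sum_const, Finset.card_univ, Fintype.card_fun, Fintype.card_fin,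
      nsmul_eq_mul]
    rw [← pow_mul, mul_comm m s]; push_cast; ring
  · rw [if_neg h, mul_zero]
    push Not at h
    obtain ⟨i, j, hj, hn⟩ := h
    have hval : (n i j).val = 1 := by
      have h1 := ZMod.val_lt (n i j)
      have h2 : (n i j).val ≠ 0 := by simpa [ZMod.val_eq_zero] using hn
      omega
    have hsum : ∑ t', walshOne n (mergeDig k t t') =
        ∏ i, ∏ j, ∑ b : Fin 2,
          (-1 : ℝ) ^ ((n i j).val * ((if (j : ℕ) < k then t i j else b : Fin 2) : ℕ)) := by
      simp only [Finset.prod_univ_sum, Fintype.piFinset_univ, walshOne, mergeDig]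
    rw [hsum]
    refine Finset.prod_eq_zero (Finset.mem_univ i) (Finset.prod_eq_zero (Finset.mem_univ j) ?_)
    simp [not_lt.mpr hj, hval]

lemma EmCond_walsh (k : ℕ) (n : Fin s → Fin m → ZMod 2) (t y : Fin s → Fin m → Fin 2) :
    EmCond m s k (walsh n) t y =
      if ∀ i, ∀ j : Fin m, k ≤ (j : ℕ) → n i j = 0 then walsh n t y else 0 := by
  have h2 : (2 : ℝ) ^ (-(2 * s * m : ℤ)) * (2 ^ (s * m) * 2 ^ (s * m)) = 1 := by
    rw [← pow_add, ← zpow_natCast, ← zpow_add₀ two_ne_zero]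
    have : (-(2 * s * m : ℤ)) + ((s * m + s * m : ℕ) : ℤ) = 0 := by push_cast; ring
    rw [this, zpow_zero]
  simp only [EmCond, walsh, ← Finset.sum_mul_sum, sum_walshOne_mergeDig]
  split_ifs
  · linear_combination (walshOne n t * walshOne n y) * h2
  · simp

lemma EmCond_sum {ι : Type*} (S : Finset ι) (w : ι → ℝ) (k : ℕ)
    (f : ι → (Fin s → Fin m → Fin 2) → (Fin s → Fin m → Fin 2) → ℝ)
    (t y : Fin s → Fin m → Fin 2) :
    EmCond m s k (fun t y => ∑ n ∈ S, w n * f n t y) t y =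
      ∑ n ∈ S, w n * EmCond m s k (f n) t y := by
  have h : ∑ t', ∑ y', ∑ n ∈ S, w n * f n (mergeDig k t t') (mergeDig k y y') =
      ∑ n ∈ S, w n * ∑ t', ∑ y', f n (mergeDig k t t') (mergeDig k y y') := by
    simp_rw [Finset.mul_sum]
    rw [Finset.sum_comm]
    simp_rw [Finset.sum_comm (s := S)]
    rw [Finset.sum_comm]
  simp only [EmCond, h]
  rw [Finset.mul_sum]
  exact Finset.sum_congr rfl fun n _ => by ring

lemma Em_eq_EmCond_zero (f : (Fin s → Fin m → Fin 2) → (Fin s → Fin m → Fin 2) → ℝ)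
    (t y : Fin s → Fin m → Fin 2) : Em m s f = EmCond m s 0 f t y := by
  have h : ∀ t t' : Fin s → Fin m → Fin 2, mergeDig 0 t t' = t' := fun t t' => by
    funext i j; simp [mergeDig]
  simp only [Em, EmCond, h]

lemma Em_sum {ι : Type*} (S : Finset ι) (w : ι → ℝ)
    (f : ι → (Fin s → Fin m → Fin 2) → (Fin s → Fin m → Fin 2) → ℝ) :
    Em m s (fun t y => ∑ n ∈ S, w n * f n t y) = ∑ n ∈ S, w n * Em m s (f n) := by
  simp only [Em_eq_EmCond_zero _ 0 0, EmCond_sum]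

lemma Em_walsh (n : Fin s → Fin m → ZMod 2) :
    Em m s (walsh n) = if n = 0 then 1 else 0 := by
  rw [Em_eq_EmCond_zero _ 0 0, EmCond_walsh]
  have h : (∀ i, ∀ j : Fin m, 0 ≤ (j : ℕ) → n i j = 0) ↔ n = 0 := by
    simp [funext_iff]
  simp only [h]
  refine if_congr Iff.rfl ?_ rfl
  simp [walsh, walshOne]

lemma Em_walsh_mul (n n' : Fin s → Fin m → ZMod 2) :
    Em m s (fun t y => walsh n t y * walsh n' t y) = if n = n' then 1 else 0 := by
  simp only [← walsh_add]
  rw [show (fun t y => walsh (n + n') t y) = walsh (n + n') from rfl, Em_walsh]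
  refine if_congr ?_ rfl rfl
  simp only [funext_iff, Pi.add_apply, Pi.zero_apply, CharTwo.add_eq_zero]

lemma Em_sum_walsh_mul_sum_walsh (a b : (Fin s → Fin m → ZMod 2) → ℝ) :
    Em m s (fun t y => (∑ n, a n * walsh n t y) * ∑ n, b n * walsh n t y) = ∑ n, a n * b n := by
  have h : (fun t y => (∑ n, a n * walsh n t y) * ∑ n, b n * walsh n t y) =
      fun t y => ∑ p : (Fin s → Fin m → ZMod 2) × (Fin s → Fin m → ZMod 2),
        (a p.1 * b p.2) * (walsh p.1 t y * walsh p.2 t y) := by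
    funext t y
    rw [Finset.sum_mul_sum, Fintype.sum_prod_type]
    exact Finset.sum_congr rfl fun _ _ => Finset.sum_congr rfl fun _ _ => by ring
  rw [h, Em_sum Finset.univ (fun p : (Fin s → Fin m → ZMod 2) × (Fin s → Fin m → ZMod 2) =>
    a p.1 * b p.2) (fun p t y => walsh p.1 t y * walsh p.2 t y), Fintype.sum_prod_type]
  simp [Em_walsh_mul]

end Walsh

section Dual

variable {m s : ℕ}

lemma zmod_two_eq_one_of_ne_zero : ∀ a : ZMod 2, a ≠ 0 → a = 1 := by decide

lemma rhoF_le_iff {b : Fin m → ZMod 2} {a : ℕ} :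
    rhoF b ≤ a ↔ ∀ j : Fin m, a ≤ (j : ℕ) → b j = 0 := by
  simp only [rhoF, Finset.sup_le_iff, Finset.mem_filter, Finset.mem_univ, true_and]
  refine forall_congr' fun j => ⟨fun h hj => ?_, fun h hb => ?_⟩
  · by_contra hb
    have := h hb
    omega
  · by_contra hj
    exact hb (h (by omega))

/-- The leading digit of an array with nonzero `rhoF`. -/
lemma exists_leading_digit {b : Fin m → ZMod 2} (hb : b ≠ 0) :
    ∃ j : Fin m, b j = 1 ∧ rhoF b = (j : ℕ) + 1 := by
  have hne : (Finset.univ.filter fun j => b j ≠ 0).Nonempty := by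
    obtain ⟨j, hj⟩ := Function.ne_iff.mp hb
    exact ⟨j, by simpa using hj⟩
  obtain ⟨j, hj, he⟩ := Finset.exists_mem_eq_sup _ hne fun j : Fin m => (j : ℕ) + 1
  exact ⟨j, zmod_two_eq_one_of_ne_zero (b j) (Finset.mem_filter.mp hj).2, he⟩

/-- Digits `x j ∈ {0, 1}` vanish below position `d` if the expansion is less than `2 ^ (-d)`. -/
lemma digit_eq_zero_of_sum_lt {x : Fin m → ZMod 2} {d : ℕ} {r : ℝ}
    (hr : r ≤ 1 / 2 ^ d)
    (h : ∑ j : Fin m, ((x j).val : ℝ) / 2 ^ ((j : ℕ) + 1) < r) {j : Fin m}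
    (hj : (j : ℕ) < d) : x j = 0 := by
  by_contra hx
  have hx1 : x j = 1 := zmod_two_eq_one_of_ne_zero (x j) hx
  have h1 : ((x j).val : ℝ) / 2 ^ ((j : ℕ) + 1) ≤
      ∑ j : Fin m, ((x j).val : ℝ) / 2 ^ ((j : ℕ) + 1) :=
    Finset.single_le_sum (f := fun j : Fin m => ((x j).val : ℝ) / 2 ^ ((j : ℕ) + 1))
      (fun _ _ => by positivity) (Finset.mem_univ j)
  have h2 : (1 : ℝ) / 2 ^ d ≤ 1 / 2 ^ ((j : ℕ) + 1) :=
    one_div_le_one_div_of_le (by positivity) (pow_le_pow_right₀ (by norm_num) (by omega))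
  have h3 : ((x j).val : ℝ) = 1 := by rw [hx1, ZMod.val_one, Nat.cast_one]
  rw [h3] at h1
  linarith

lemma sum_half_pow_lt (m : ℕ) (k : ℕ) :
    ∑ j ∈ Finset.univ.filter (fun j : Fin m => k < (j : ℕ)), (1 : ℝ) / 2 ^ ((j : ℕ) + 1) <
      1 / 2 ^ (k + 1) := by
  have h : ∀ n : ℕ, ∑ j ∈ (Finset.range n).filter (fun j => k < j), (1 : ℝ) / 2 ^ (j + 1) <
      1 / 2 ^ (k + 1) ∧ (k < n → ∑ j ∈ (Finset.range n).filter (fun j => k < j),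
      (1 : ℝ) / 2 ^ (j + 1) = 1 / 2 ^ (k + 1) - 1 / 2 ^ n) := by
    intro n
    have h2 : k < n → ∑ j ∈ (Finset.range n).filter (fun j => k < j),
      (1 : ℝ) / 2 ^ (j + 1) = 1 / 2 ^ (k + 1) - 1 / 2 ^ n := by
      induction n with
      | zero => omega
      | succ n ih =>
        intro hn
        rw [Finset.range_add_one, Finset.filter_insert]
        split_ifs with hk
        · rw [Finset.sum_insert (by simp), ih hk, pow_succ (2 : ℝ) n]
          field_simp
          ring
        · obtain rfl : k = n := by omega
          rw [Finset.filter_false_of_mem (by intro x hx; have := Finset.mem_range.mp hx; omega)]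
          simp
    refine ⟨?_, h2⟩
    by_cases hn : k < n
    · rw [h2 hn]
      have : (0 : ℝ) < 1 / 2 ^ n := by positivity
      linarith
    · rw [Finset.filter_false_of_mem (by intro x hx; have := Finset.mem_range.mp hx; omega)]
      simp
  have h1 := (h m).1
  rw [Finset.sum_filter, Finset.sum_range] at h1
  rwa [Finset.sum_filter]

/-- An expansion in `[2 ^ (-(k + 1)), 2 ^ (-(k + 1)) + 2 ^ (-d))` with `k < d` has its first
nonzero digit at position `k`. -/
lemma digit_eq_of_sum_mem {x : Fin m → ZMod 2} {d : ℕ} {k : Fin m} (hk : (k : ℕ) < d)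
    (hl : (1 : ℝ) / 2 ^ ((k : ℕ) + 1) ≤ ∑ j : Fin m, ((x j).val : ℝ) / 2 ^ ((j : ℕ) + 1))
    (hu : ∑ j : Fin m, ((x j).val : ℝ) / 2 ^ ((j : ℕ) + 1) <
      1 / 2 ^ ((k : ℕ) + 1) + 1 / 2 ^ d) :
    (∀ j : Fin m, j < k → x j = 0) ∧ x k = 1 := by
  have h0 : ∀ j : Fin m, j < k → x j = 0 := by
    intro j hj
    refine digit_eq_zero_of_sum_lt (d := k) ?_ hu (by exact_mod_cast hj)
    have h2 : (1 : ℝ) / 2 ^ d ≤ 1 / 2 ^ ((k : ℕ) + 1) :=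
      one_div_le_one_div_of_le (by positivity) (pow_le_pow_right₀ (by norm_num) (by omega))
    have h3 : (1 : ℝ) / 2 ^ ((k : ℕ) + 1) + 1 / 2 ^ ((k : ℕ) + 1) = 1 / 2 ^ (k : ℕ) := by
      rw [pow_succ]; field_simp; norm_num
    linarith
  refine ⟨h0, zmod_two_eq_one_of_ne_zero (x k) fun hxk => ?_⟩
  have h1 : ∑ j : Fin m, ((x j).val : ℝ) / 2 ^ ((j : ℕ) + 1) ≤
      ∑ j ∈ Finset.univ.filter (fun j : Fin m => (k : ℕ) < (j : ℕ)),
        (1 : ℝ) / 2 ^ ((j : ℕ) + 1) := by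
    rw [Finset.sum_filter]
    refine Finset.sum_le_sum fun j _ => ?_
    split_ifs with hj
    · have : (x j).val ≤ 1 := Nat.lt_succ_iff.mp (ZMod.val_lt (x j))
      gcongr
      exact_mod_cast this
    · rcases (not_lt.mp hj).lt_or_eq with hj | hj
      · simp [h0 j (by exact_mod_cast hj)]
      · rw [Fin.ext hj, hxk, ZMod.val_zero]; simp
  linarith [sum_half_pow_lt m k]

/-- The dual net of a digital `(t,m,s)`-net has minimum distance greater than `m - t`. -/
lemma lt_sum_rhoF_of_mem_dualNet {tm : ℕ} {C : Fin s → Matrix (Fin m) (Fin m) (ZMod 2)}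
    (hnet : IsNet tm m s (fun n : Fin (2 ^ m) => netPoint m s C (n : ℕ)))
    {mm : Fin s → Fin m → ZMod 2} (hmm : mm ∈ dualNet m s C) (h0 : mm ≠ 0) :
    m < (∑ i, rhoF (mm i)) + tm := by
  by_contra hle
  obtain ⟨i₀, hi₀⟩ := Function.ne_iff.mp h0
  obtain ⟨k, hk1, hkρ⟩ := exists_leading_digit hi₀
  set d : Fin s → ℕ := fun i => rhoF (mm i) +
    if i = i₀ then m - tm - ∑ i, rhoF (mm i) else 0 with hd
  have hdle : ∀ i, rhoF (mm i) ≤ d i := fun i => Nat.le_add_right _ _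
  have hkd : (k : ℕ) < d i₀ := by have := hdle i₀; omega
  have hsum : (∑ i, d i) + tm = m := by
    simp only [hd, Finset.sum_add_distrib, Finset.sum_ite_eq', Finset.mem_univ, if_true]
    omega
  set a : Fin s → ℕ := fun i => if i = i₀ then 2 ^ (d i - 1 - k) else 0 with ha
  have hbox := hnet d a (fun i => by
    simp only [ha]
    split_ifs with h
    · subst h
      exact Nat.pow_lt_pow_right (by norm_num) (by omega)
    · positivity) hsum
  obtain ⟨n, hn⟩ : (Finset.univ.filter fun n : Fin (2 ^ m) => ∀ i,
      (a i : ℝ) / 2 ^ d i ≤ netPoint m s C (n : ℕ) i ∧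
        netPoint m s C (n : ℕ) i < ((a i : ℝ) + 1) / 2 ^ d i).Nonempty := by
    rw [← Finset.card_pos, hbox]; positivity
  simp only [Finset.mem_filter, Finset.mem_univ, true_and] at hn
  have hother : ∀ i, i ≠ i₀ → ∀ j, mm i j * netDig m s C (n : ℕ) i j = 0 := by
    intro i hi j
    rcases lt_or_ge (j : ℕ) (d i) with hj | hj
    · have h := (hn i).2
      simp only [ha, if_neg hi, Nat.cast_zero, zero_add] at h
      rw [digit_eq_zero_of_sum_lt le_rfl h hj, mul_zero]
    · rw [rhoF_le_iff.mp (hdle i) j hj, zero_mul]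
  have hmain := hn i₀
  have hpow : ((a i₀ : ℕ) : ℝ) / 2 ^ d i₀ = 1 / 2 ^ ((k : ℕ) + 1) := by
    simp only [ha, if_true]
    have : (2 : ℝ) ^ d i₀ = 2 ^ (d i₀ - 1 - k) * 2 ^ ((k : ℕ) + 1) := by
      rw [← pow_add]; congr 1; omega
    rw [this]; push_cast; field_simp
  rw [add_div, hpow] at hmain
  obtain ⟨hlow, hk⟩ := digit_eq_of_sum_mem hkd hmain.1 hmain.2
  have hdual := (Finset.mem_filter.mp hmm).2 n
  rw [Finset.sum_eq_single i₀ (fun i _ hi => Finset.sum_eq_zero fun j _ => hother i hi j)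
    (by simp), Finset.sum_eq_single k] at hdual
  · rw [hk1, hk] at hdual
    simp at hdual
  · intro j _ hj
    rcases lt_or_gt_of_ne hj with h | h
    · rw [hlow j h, mul_zero]
    · rw [rhoF_le_iff.mp hkρ.le j (by have : (k : ℕ) < j := h; omega), zero_mul]
  · simp

/-- The elements of the dual net supported in the box `A`. -/
def dualBox (m s : ℕ) (C : Fin s → Matrix (Fin m) (Fin m) (ZMod 2)) (A : Fin s → ℕ) :
    Finset (Fin s → Fin m → ZMod 2) :=
  (dualNet m s C).filter fun mm => ∀ i, rhoF (mm i) ≤ A i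

lemma mem_dualNet_add {C : Fin s → Matrix (Fin m) (Fin m) (ZMod 2)}
    {x y : Fin s → Fin m → ZMod 2} (hx : x ∈ dualNet m s C) (hy : y ∈ dualNet m s C) :
    x + y ∈ dualNet m s C := by
  simp only [dualNet, Finset.mem_filter, Finset.mem_univ, true_and] at *
  intro n
  simp only [Pi.add_apply, add_mul, Finset.sum_add_distrib, hx n, hy n, add_zero]

lemma mem_dualBox_add {C : Fin s → Matrix (Fin m) (Fin m) (ZMod 2)} {A : Fin s → ℕ}
    {x y : Fin s → Fin m → ZMod 2} (hx : x ∈ dualBox m s C A) (hy : y ∈ dualBox m s C A) :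
    x + y ∈ dualBox m s C A := by
  simp only [dualBox, Finset.mem_filter, rhoF_le_iff] at *
  exact ⟨mem_dualNet_add hx.1 hy.1, fun i j hj => by simp [hx.2 i j hj, hy.2 i j hj]⟩

lemma exists_le_sum_eq {ι : Type*} [Fintype ι] (A : ι → ℕ) :
    ∀ n ≤ ∑ i, A i, ∃ B : ι → ℕ, B ≤ A ∧ ∑ i, B i = n := by
  intro n
  induction n with
  | zero => exact fun _ => ⟨0, fun _ => Nat.zero_le _, by simp⟩
  | succ n ih =>
    intro hn
    obtain ⟨B, hB, hBn⟩ := ih (by omega)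
    obtain ⟨i, -, hi⟩ := Finset.exists_lt_of_sum_lt (s := Finset.univ) (f := B) (g := A) (by omega)
    refine ⟨B + Pi.single i 1, fun j => ?_, ?_⟩
    · by_cases hj : j = i
      · subst hj; simpa using hi
      · simpa [hj] using hB j
    · simp [Finset.sum_add_distrib, hBn]

/-- A box of side sum at least `m - t` contains at most `2 ^ (a₀(A) - (m - t))` dual vectors. -/
lemma card_dualBox_le {tm : ℕ} {C : Fin s → Matrix (Fin m) (Fin m) (ZMod 2)}
    (hnet : IsNet tm m s (fun n : Fin (2 ^ m) => netPoint m s C (n : ℕ)))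
    (htm : tm ≤ m) {A : Fin s → ℕ} (hA : m - tm ≤ a0F A) :
    (dualBox m s C A).card ≤ 2 ^ (a0F A - (m - tm)) := by
  obtain ⟨B, hBA, hB⟩ := exists_le_sum_eq A (m - tm) hA
  have hcard : Fintype.card (∀ i, Fin (A i - B i) → ZMod 2) = 2 ^ (a0F A - (m - tm)) := by
    simp only [Fintype.card_pi, ZMod.card, Fintype.card_fin, Finset.prod_const,
      Finset.card_univ]
    rw [Finset.prod_pow_eq_pow_sum]
    congr 1
    rw [Finset.sum_tsub_distrib _ fun i _ => hBA i, hB]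
    rfl
  rw [← hcard]
  refine Finset.card_le_card_of_injOn (t := Finset.univ)
    (fun mm i j => if h : B i + (j : ℕ) < m then mm i ⟨B i + j, h⟩ else 0)
    (fun _ _ => Finset.mem_coe.mpr (Finset.mem_univ _)) ?_
  intro x hx y hy hxy
  by_contra hne
  have hx' := Finset.mem_coe.mp hx
  have hy' := Finset.mem_coe.mp hy
  have hadd := Finset.mem_filter.mp (mem_dualBox_add hx' hy')
  have h0 : x + y ≠ 0 := by
    intro h
    refine hne (funext fun i => funext fun j => ?_)
    exact CharTwo.add_eq_zero.mp (congrFun (congrFun h i) j)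
  have hlt := lt_sum_rhoF_of_mem_dualNet hnet hadd.1 h0
  have hle : ∑ i, rhoF ((x + y) i) ≤ ∑ i, B i := by
    refine Finset.sum_le_sum fun i _ => rhoF_le_iff.mpr fun j hj => ?_
    rcases lt_or_ge (j : ℕ) (A i) with hjA | hjA
    · have h := congrFun (congrFun hxy i) ⟨(j : ℕ) - B i, by omega⟩
      have hidx : B i + ((j : ℕ) - B i) = j := by omega
      simp only [hidx, j.2, dif_pos] at h
      exact CharTwo.add_eq_zero.mpr h
    · exact rhoF_le_iff.mp (hadd.2 i) j hjA
  omega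

end Dual

section Theta

variable {m s : ℕ}

/-- The `n`-th Walsh coefficient of `Ψ_A ^ 2`. -/
def psiSqCoeff (m s : ℕ) (C : Fin s → Matrix (Fin m) (Fin m) (ZMod 2)) (A : Fin s → ℕ)
    (n : Fin s → Fin m → ZMod 2) : ℝ :=
  ((2 : ℝ) ^ ((m : ℤ) - (s : ℤ) - (a0F A : ℤ))) ^ 2 *
    ∑ p ∈ ((dualBox m s C A).filter (· ≠ 0) ×ˢ (dualBox m s C A).filter (· ≠ 0)).filter
      (fun p => p.1 + p.2 = n),
      (-1 : ℝ) ^ (∑ i, mAt (p.1 i) (A i)) * (-1 : ℝ) ^ (∑ i, mAt (p.2 i) (A i))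

lemma LamF_eq_sum_walsh (C : Fin s → Matrix (Fin m) (Fin m) (ZMod 2)) (A : Fin s → ℕ)
    (t y : Fin s → Fin m → Fin 2) :
    LamF m s C A t y = ∑ n ∈ (dualBox m s C A).filter (· ≠ 0),
      (-1 : ℝ) ^ (∑ i, mAt (n i) (A i)) * walsh n t y := by
  rw [LamF, dualBox, Finset.filter_filter]
  refine Finset.sum_congr (Finset.filter_congr fun _ _ => and_comm) fun n _ => ?_
  rw [walsh_eq_pow, Finset.sum_add_distrib, pow_add, mul_comm]

lemma PsiF_mul_self (C : Fin s → Matrix (Fin m) (Fin m) (ZMod 2)) (A : Fin s → ℕ)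
    (t y : Fin s → Fin m → Fin 2) :
    PsiF m s C A t y * PsiF m s C A t y = ∑ n, psiSqCoeff m s C A n * walsh n t y := by
  have hr : rademF A y * rademF A y = 1 := by
    rw [rademF, ← Finset.prod_mul_distrib]
    exact Finset.prod_eq_one fun i _ => by rw [← mul_pow]; simp
  have hk : (-1 : ℝ) ^ kapF A * (-1 : ℝ) ^ kapF A = 1 := by rw [← mul_pow]; simp
  have hL : LamF m s C A t y * LamF m s C A t y = ∑ n, (∑ p ∈
      ((dualBox m s C A).filter (· ≠ 0) ×ˢ (dualBox m s C A).filter (· ≠ 0)).filter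
      (fun p => p.1 + p.2 = n),
      (-1 : ℝ) ^ (∑ i, mAt (p.1 i) (A i)) * (-1 : ℝ) ^ (∑ i, mAt (p.2 i) (A i))) *
        walsh n t y := by
    rw [LamF_eq_sum_walsh, Finset.sum_mul_sum, ← Finset.sum_product',
      ← Finset.sum_fiberwise (g := fun p => p.1 + p.2)]
    refine Finset.sum_congr rfl fun n _ => ?_
    rw [Finset.sum_mul]
    refine Finset.sum_congr rfl fun p hp => ?_
    rw [← (Finset.mem_filter.mp hp).2, walsh_add]
    ring
  simp only [psiSqCoeff, mul_assoc, ← Finset.mul_sum]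
  rw [← hL, PsiF]
  linear_combination ((2 : ℝ) ^ ((m : ℤ) - (s : ℤ) - (a0F A : ℤ))) ^ 2 *
    (LamF m s C A t y) ^ 2 * ((rademF A y * rademF A y) * hk + hr)

lemma psiSqCoeff_eq_zero {C : Fin s → Matrix (Fin m) (Fin m) (ZMod 2)} {A : Fin s → ℕ}
    {n : Fin s → Fin m → ZMod 2} (hn : n ∉ dualBox m s C A) : psiSqCoeff m s C A n = 0 := by
  rw [psiSqCoeff, Finset.filter_false_of_mem, Finset.sum_empty, mul_zero]
  intro p hp h
  rw [Finset.mem_product, Finset.mem_filter, Finset.mem_filter] at hp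
  exact hn (h ▸ mem_dualBox_add hp.1.1 hp.2.1)

lemma abs_psiSqCoeff_le (C : Fin s → Matrix (Fin m) (Fin m) (ZMod 2)) (A : Fin s → ℕ)
    (n : Fin s → Fin m → ZMod 2) :
    |psiSqCoeff m s C A n| ≤ ((2 : ℝ) ^ ((m : ℤ) - (a0F A : ℤ))) ^ 2 * (dualBox m s C A).card := by
  rw [psiSqCoeff, abs_mul, abs_of_nonneg (sq_nonneg _)]
  refine mul_le_mul ?_ ?_ (abs_nonneg _) (sq_nonneg _)
  · gcongr
    · norm_num
    · omega
  · refine (Finset.abs_sum_le_sum_abs _ _).trans ?_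
    simp only [abs_mul, abs_pow, abs_neg, abs_one, one_pow, mul_one, Finset.sum_const,
      nsmul_eq_mul]
    norm_cast
    refine Finset.card_le_card_of_injOn Prod.fst (fun p hp => ?_) fun p hp q hq hpq => ?_
    · have h := (Finset.mem_filter.mp (Finset.mem_coe.mp hp)).1
      exact (Finset.mem_filter.mp (Finset.mem_product.mp h).1).1
    · have h := (Finset.mem_filter.mp (Finset.mem_coe.mp hp)).2
      have h' := (Finset.mem_filter.mp (Finset.mem_coe.mp hq)).2
      exact Prod.ext hpq (add_left_cancel (a := p.1) (by rw [h, hpq, h']))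

lemma ThetaF_eq_sum_walsh (C : Fin s → Matrix (Fin m) (Fin m) (ZMod 2)) (A : Fin s → ℕ) (k : ℕ)
    (t y : Fin s → Fin m → Fin 2) :
    ThetaF m s C A A k t y = ∑ n, (if n ≠ 0 ∧ ∀ i, ∀ j : Fin m, k - 1 ≤ (j : ℕ) → n i j = 0
      then psiSqCoeff m s C A n else 0) * walsh n t y := by
  simp only [ThetaF, PsiF_mul_self]
  rw [EmCond_sum Finset.univ (psiSqCoeff m s C A) (k - 1) walsh,
    Em_sum Finset.univ (psiSqCoeff m s C A) walsh, ← Finset.sum_sub_distrib]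
  refine Finset.sum_congr rfl fun n _ => ?_
  rw [EmCond_walsh, Em_walsh]
  by_cases hn : n = 0
  · subst hn; simp [walsh, walshOne]
  · by_cases h : ∀ i, ∀ j : Fin m, k - 1 ≤ (j : ℕ) → n i j = 0
    · rw [if_pos h, if_neg hn, if_pos ⟨hn, h⟩]; ring
    · rw [if_neg h, if_neg hn, if_neg fun h' => h h'.2]; ring

lemma abs_Em_ThetaF_mul_le {tm : ℕ} {C : Fin s → Matrix (Fin m) (Fin m) (ZMod 2)}
    (hnet : IsNet tm m s (fun n : Fin (2 ^ m) => netPoint m s C (n : ℕ))) (htm : tm ≤ m)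
    {A B : Fin s → ℕ} (hA : m < a0F A + tm) (hB : m < a0F B + tm) (k₁ k₂ : ℕ) :
    |Em m s fun t y => ThetaF m s C A A k₁ t y * ThetaF m s C B B k₂ t y| ≤
      if m < (∑ i, min (A i) (B i)) + tm then (2 : ℝ) ^ (4 * tm) else 0 := by
  simp only [ThetaF_eq_sum_walsh]
  rw [Em_sum_walsh_mul_sum_walsh]
  refine (Finset.abs_sum_le_sum_abs _ _).trans ?_
  set cA := ((2 : ℝ) ^ ((m : ℤ) - (a0F A : ℤ))) ^ 2 * (dualBox m s C A).card
  set cB := ((2 : ℝ) ^ ((m : ℤ) - (a0F B : ℤ))) ^ 2 * (dualBox m s C B).card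
  have hterm : ∀ n : Fin s → Fin m → ZMod 2,
      |(if n ≠ 0 ∧ ∀ i, ∀ j : Fin m, k₁ - 1 ≤ (j : ℕ) → n i j = 0
        then psiSqCoeff m s C A n else 0) *
      (if n ≠ 0 ∧ ∀ i, ∀ j : Fin m, k₂ - 1 ≤ (j : ℕ) → n i j = 0
        then psiSqCoeff m s C B n else 0)| ≤
      if n ≠ 0 ∧ n ∈ dualBox m s C A ∧ n ∈ dualBox m s C B then cA * cB else 0 := by
    intro n
    by_cases h : n ≠ 0 ∧ n ∈ dualBox m s C A ∧ n ∈ dualBox m s C B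
    · rw [if_pos h, abs_mul]
      refine mul_le_mul ?_ ?_ (abs_nonneg _) (by positivity)
      · split_ifs
        · exact abs_psiSqCoeff_le C A n
        · rw [abs_zero]; positivity
      · split_ifs
        · exact abs_psiSqCoeff_le C B n
        · rw [abs_zero]; positivity
    · rw [if_neg h, abs_nonpos_iff, mul_eq_zero]
      by_cases hn : n = 0
      · exact Or.inl (if_neg fun h' => h'.1 hn)
      by_cases hnA : n ∈ dualBox m s C A
      · exact Or.inr (by rw [psiSqCoeff_eq_zero fun hnB => h ⟨hn, hnA, hnB⟩, ite_self])
      · exact Or.inl (by rw [psiSqCoeff_eq_zero hnA, ite_self])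
  refine (Finset.sum_le_sum fun n _ => hterm n).trans ?_
  rw [← Finset.sum_filter, Finset.sum_const, nsmul_eq_mul]
  split_ifs with h
  · have hN : (((Finset.univ.filter fun n : Fin s → Fin m → ZMod 2 =>
        n ≠ 0 ∧ n ∈ dualBox m s C A ∧ n ∈ dualBox m s C B).card : ℕ) : ℝ) ≤
        (2 : ℝ) ^ (a0F A - (m - tm)) := by
      exact_mod_cast (Finset.card_le_card (t := dualBox m s C A) fun n hn => by
        simp only [Finset.mem_filter] at hn
        exact hn.2.2.1).trans
        (card_dualBox_le hnet htm (A := A) (by omega))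
    have hcA : ((dualBox m s C A).card : ℝ) ≤ (2 : ℝ) ^ (a0F A - (m - tm)) := by
      exact_mod_cast card_dualBox_le hnet htm (by omega)
    have hcB : ((dualBox m s C B).card : ℝ) ≤ (2 : ℝ) ^ (a0F B - (m - tm)) := by
      exact_mod_cast card_dualBox_le hnet htm (by omega)
    calc _ ≤ (2 : ℝ) ^ (a0F A - (m - tm)) *
          ((((2 : ℝ) ^ ((m : ℤ) - (a0F A : ℤ))) ^ 2 * (2 : ℝ) ^ (a0F A - (m - tm))) *
          (((2 : ℝ) ^ ((m : ℤ) - (a0F B : ℤ))) ^ 2 * (2 : ℝ) ^ (a0F B - (m - tm)))) := by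
          simp only [cA, cB]
          gcongr
      _ = (2 : ℝ) ^ ((m : ℤ) - a0F B + 3 * tm) := by
          simp only [← zpow_natCast, ← zpow_mul, ← zpow_add₀ (two_ne_zero' ℝ)]
          congr 1
          push_cast [Nat.cast_sub (show m - tm ≤ a0F A by omega),
            Nat.cast_sub (show m - tm ≤ a0F B by omega), Nat.cast_sub htm]
          ring
      _ ≤ (2 : ℝ) ^ (4 * tm) := by
          rw [← zpow_natCast]
          refine zpow_le_zpow_right₀ (by norm_num) ?_
          push_cast
          omega
  · rw [Finset.filter_false_of_mem]
    · simp
    · rintro n - ⟨hn0, hnA, hnB⟩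
      have hA' := Finset.mem_filter.mp hnA
      have hB' := Finset.mem_filter.mp hnB
      have := lt_sum_rhoF_of_mem_dualNet hnet hA'.1 hn0
      have hle : ∑ i, rhoF (n i) ≤ ∑ i, min (A i) (B i) :=
        Finset.sum_le_sum fun i _ => le_min (hA'.2 i) (hB'.2 i)
      omega

end Theta

section Counting

variable {m s : ℕ}

/-- All indices `A` with `a₀(A) ∈ (m - t, m + V₀)`, i.e. the union of the sets `IndexSet`. -/
def indexBand (m s tm : ℕ) : Finset (Fin s → ℕ) :=
  (Fintype.piFinset fun _ : Fin s => Finset.range (m + 1)).filter fun A =>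
    (m : ℝ) - tm < a0F A ∧ (a0F A : ℝ) < m + V0 m

lemma lt_a0F_add_of_mem_indexBand {tm : ℕ} {A : Fin s → ℕ} (hA : A ∈ indexBand m s tm) :
    m < a0F A + tm := by
  have h := (Finset.mem_filter.mp hA).2.1
  have h' : (m : ℝ) < a0F A + tm := by linarith
  exact_mod_cast h'

lemma a0F_lt_of_mem_indexBand {tm : ℕ} {A : Fin s → ℕ} (hA : A ∈ indexBand m s tm) :
    a0F A < m + ⌈V0 m⌉₊ := by
  have h := (Finset.mem_filter.mp hA).2.2
  have h' : (a0F A : ℝ) < m + ⌈V0 m⌉₊ := by linarith [Nat.le_ceil (V0 m)]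
  exact_mod_cast h'

lemma IndexSet_eq_filter (m s tm k : ℕ) :
    IndexSet m s tm k = (indexBand m s tm).filter fun A => Finset.univ.sup A = k := by
  rw [IndexSet, indexBand, Finset.filter_filter]
  exact Finset.filter_congr fun _ _ => and_comm

lemma sum_IndexSet_le (m s tm : ℕ) {f : (Fin s → ℕ) → ℝ} (hf : ∀ A, 0 ≤ f A) :
    ∑ k ∈ Finset.Icc 1 m, ∑ A ∈ IndexSet m s tm k, f A ≤ ∑ A ∈ indexBand m s tm, f A := by
  simp only [IndexSet_eq_filter]
  exact Finset.sum_fiberwise_le_sum_of_sum_fiber_nonneg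
    fun _ _ => Finset.sum_nonneg fun A _ => hf A

lemma abs_Ups_univ_le {tm : ℕ} {C : Fin s → Matrix (Fin m) (Fin m) (ZMod 2)}
    (hnet : IsNet tm m s (fun n : Fin (2 ^ m) => netPoint m s C (n : ℕ))) (htm : tm ≤ m)
    (k₁ k₂ : ℕ) :
    |Ups m s tm C Finset.univ ∅ ∅ k₁ k₂| ≤
      ∑ A ∈ IndexSet m s tm k₁, ∑ B ∈ IndexSet m s tm k₂,
        if m < (∑ i, min (A i) (B i)) + tm then (2 : ℝ) ^ (4 * tm) else 0 := by
  have heq : ∀ A A' : Fin s → ℕ, (Finset.univ.filter fun i => A i = A' i) = Finset.univ →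
      A' = A := fun A A' h => funext fun i =>
    ((Finset.mem_filter.mp (h.symm ▸ Finset.mem_univ i)).2).symm
  rw [Ups]
  refine (Finset.abs_sum_le_sum_abs _ _).trans (Finset.sum_le_sum fun A hA => ?_)
  rw [Finset.sum_eq_single_of_mem A hA]
  · refine (Finset.abs_sum_le_sum_abs _ _).trans (Finset.sum_le_sum fun B hB => ?_)
    rw [Finset.sum_eq_single_of_mem B hB]
    · rw [if_pos (by simp), mul_one]
      rw [IndexSet_eq_filter] at hA hB
      exact abs_Em_ThetaF_mul_le hnet htm
        (lt_a0F_add_of_mem_indexBand (Finset.mem_filter.mp hA).1)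
        (lt_a0F_add_of_mem_indexBand (Finset.mem_filter.mp hB).1) k₁ k₂
    · intro B' _ hne
      rw [if_neg fun h => hne (heq _ _ h.2.2.2.1), mul_zero]
  · intro A' _ hne
    refine Finset.sum_eq_zero fun B _ => Finset.sum_eq_zero fun B' _ => ?_
    rw [if_neg fun h => hne (heq _ _ h.1), mul_zero]

lemma card_indexBand_le (m s tm : ℕ) (htm : tm ≤ m) :
    (indexBand m (s + 1) tm).card ≤ (m + 1) ^ s * (⌈V0 m⌉₊ + tm) := by
  have hcard : ((Fintype.piFinset fun _ : Fin s => Finset.range (m + 1)) ×ˢ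
      Finset.Ioo (m - tm) (m + ⌈V0 m⌉₊)).card ≤ (m + 1) ^ s * (⌈V0 m⌉₊ + tm) := by
    rw [Finset.card_product, Fintype.card_piFinset_const, Finset.card_range, Nat.card_Ioo]
    gcongr
    omega
  refine le_trans (Finset.card_le_card_of_injOn (fun A => (Fin.tail A, a0F A)) ?_ ?_) hcard
  · intro A hA
    have hA' := Finset.mem_coe.mp hA
    have h₁ := lt_a0F_add_of_mem_indexBand hA'
    have h₂ := a0F_lt_of_mem_indexBand hA'
    have h₃ := Fintype.mem_piFinset.mp (Finset.mem_filter.mp hA').1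
    refine Finset.mem_coe.mpr (Finset.mem_product.mpr
      ⟨Fintype.mem_piFinset.mpr fun i => h₃ i.succ, Finset.mem_Ioo.mpr ⟨?_, h₂⟩⟩)
    show m - tm < a0F A
    omega
  · intro A _ B _ h
    have h₁ : Fin.tail A = Fin.tail B := congrArg Prod.fst h
    have h₂ : a0F A = a0F B := congrArg Prod.snd h
    have h₃ : ∀ i : Fin s, A i.succ = B i.succ := fun i => congrFun h₁ i
    simp only [a0F, Fin.sum_univ_succ, h₃] at h₂
    exact funext (Fin.cases (by omega) h₃)

lemma card_filter_min_le (m s tm : ℕ) {A : Fin s → ℕ} (hA : A ∈ indexBand m s tm) :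
    ((indexBand m s tm).filter fun B => m < (∑ i, min (A i) (B i)) + tm).card ≤
      (2 * (⌈V0 m⌉₊ + tm) + 1) ^ s := by
  set W := ⌈V0 m⌉₊ + tm with hW
  have hdiff : ∀ D E : Fin s → ℕ, E ∈ indexBand m s tm →
      m < (∑ i, min (D i) (E i)) + tm → ∀ i, E i ≤ D i + W := by
    intro D E hE hDE i
    have h₁ : E i - min (D i) (E i) ≤ ∑ i, (E i - min (D i) (E i)) :=
      Finset.single_le_sum (f := fun i => E i - min (D i) (E i)) (fun _ _ => Nat.zero_le _)
        (Finset.mem_univ i)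
    rw [Finset.sum_tsub_distrib _ fun i _ => min_le_right _ _] at h₁
    have h₂ : (∑ i, E i) < m + ⌈V0 m⌉₊ := a0F_lt_of_mem_indexBand hE
    have h₃ := min_le_left (D i) (E i)
    omega
  calc _ ≤ (Fintype.piFinset fun i => Finset.Icc (A i - W) (A i + W)).card := by
        refine Finset.card_le_card fun B hB => Fintype.mem_piFinset.mpr fun i => ?_
        simp only [Finset.mem_filter] at hB
        have h₁ := hdiff A B hB.1 hB.2 i
        have h₂ := hdiff B A hA (by simpa only [min_comm] using hB.2) i
        rw [Finset.mem_Icc]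
        omega
    _ ≤ _ := by
        rw [Fintype.card_piFinset]
        refine (Finset.prod_le_pow_card _ _ (2 * W + 1) fun i _ => ?_).trans (by simp)
        rw [Nat.card_Icc]
        omega

lemma sum_abs_Ups_univ_le {tm : ℕ} {C : Fin (s + 1) → Matrix (Fin m) (Fin m) (ZMod 2)}
    (hnet : IsNet tm m (s + 1) (fun n : Fin (2 ^ m) => netPoint m (s + 1) C (n : ℕ)))
    (htm : tm ≤ m) :
    ∑ k₁ ∈ Finset.Icc 1 m, ∑ k₂ ∈ Finset.Icc 1 m, |Ups m (s + 1) tm C Finset.univ ∅ ∅ k₁ k₂| ≤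
      (2 : ℝ) ^ (4 * tm) * (m + 1) ^ s * (2 * (⌈V0 m⌉₊ + tm : ℕ) + 1) ^ (s + 2) := by
  set F : (Fin (s + 1) → ℕ) → (Fin (s + 1) → ℕ) → ℝ := fun A B =>
    if m < (∑ i, min (A i) (B i)) + tm then (2 : ℝ) ^ (4 * tm) else 0
  have hF : ∀ A B, 0 ≤ F A B := fun A B => by simp only [F]; positivity
  set W := ⌈V0 m⌉₊ + tm
  calc _ ≤ ∑ k₁ ∈ Finset.Icc 1 m, ∑ k₂ ∈ Finset.Icc 1 m,
          ∑ A ∈ IndexSet m (s + 1) tm k₁, ∑ B ∈ IndexSet m (s + 1) tm k₂, F A B :=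
        Finset.sum_le_sum fun k₁ _ => Finset.sum_le_sum fun k₂ _ =>
          abs_Ups_univ_le hnet htm k₁ k₂
    _ = ∑ k₁ ∈ Finset.Icc 1 m, ∑ A ∈ IndexSet m (s + 1) tm k₁,
          ∑ k₂ ∈ Finset.Icc 1 m, ∑ B ∈ IndexSet m (s + 1) tm k₂, F A B :=
        Finset.sum_congr rfl fun _ _ => Finset.sum_comm
    _ ≤ ∑ A ∈ indexBand m (s + 1) tm,
          ∑ k₂ ∈ Finset.Icc 1 m, ∑ B ∈ IndexSet m (s + 1) tm k₂, F A B :=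
        sum_IndexSet_le m (s + 1) tm fun A => Finset.sum_nonneg fun _ _ =>
          Finset.sum_nonneg fun B _ => hF A B
    _ ≤ ∑ A ∈ indexBand m (s + 1) tm, ∑ B ∈ indexBand m (s + 1) tm, F A B :=
        Finset.sum_le_sum fun A _ => sum_IndexSet_le m (s + 1) tm (hF A)
    _ ≤ ∑ A ∈ indexBand m (s + 1) tm, (2 * (W : ℝ) + 1) ^ (s + 1) * (2 : ℝ) ^ (4 * tm) := by
        refine Finset.sum_le_sum fun A hA => ?_
        simp only [F]
        rw [← Finset.sum_filter, Finset.sum_const, nsmul_eq_mul]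
        gcongr
        exact_mod_cast card_filter_min_le m (s + 1) tm hA
    _ ≤ ((m + 1) ^ s * W) * ((2 * (W : ℝ) + 1) ^ (s + 1) * (2 : ℝ) ^ (4 * tm)) := by
        rw [Finset.sum_const, nsmul_eq_mul]
        gcongr
        exact_mod_cast card_indexBand_le m s tm htm
    _ ≤ ((m + 1) ^ s * (2 * W + 1)) * ((2 * (W : ℝ) + 1) ^ (s + 1) * (2 : ℝ) ^ (4 * tm)) := by
        gcongr
        linarith [(Nat.cast_nonneg W : (0 : ℝ) ≤ W)]
    _ = _ := by ring

end Counting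

/-- The polylogarithmic factor `(2W + 1) ^ n`, `W = ⌈V₀⌉ + t`, is `≪ m ^ (1 / 5)`. -/
lemma polylog_factor_le {m tm n : ℕ} (hm : 1 ≤ m) (hn : 0 < n)
    (ht : (tm : ℝ) ≤ Real.logb 2 m / 10) :
    (2 * ((⌈V0 m⌉₊ + tm : ℕ) : ℝ) + 1) ^ n ≤ (220 * (n : ℝ) + 3) ^ n * (m : ℝ) ^ (1 / 5 : ℝ) := by
  have hm' : (1 : ℝ) ≤ m := by exact_mod_cast hm
  have hn' : (0 : ℝ) < n := by exact_mod_cast hn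
  set ε : ℝ := 1 / (5 * n)
  have hε : 0 < ε := by positivity
  have hlog := Real.log_le_rpow_div (Nat.cast_nonneg m) hε
  have hlog0 : 0 ≤ Real.log m := Real.log_nonneg hm'
  have hL : Real.logb 2 m ≤ 2 * Real.log m := by
    rw [Real.logb, div_le_iff₀ (Real.log_pos one_lt_two)]
    nlinarith [Real.log_two_gt_d9]
  have hL0 : 0 ≤ Real.logb 2 m := Real.logb_nonneg one_lt_two hm'
  have hone : 1 ≤ (m : ℝ) ^ ε := Real.one_le_rpow hm' hε.le
  have hceil : (⌈V0 m⌉₊ : ℝ) < V0 m + 1 := Nat.ceil_lt_add_one (by unfold V0; positivity)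
  have hdiv : (m : ℝ) ^ ε / ε = 5 * n * (m : ℝ) ^ ε := by
    simp only [ε]; field_simp
  have hbase : 2 * ((⌈V0 m⌉₊ + tm : ℕ) : ℝ) + 1 ≤ (220 * (n : ℝ) + 3) * (m : ℝ) ^ ε := by
    rw [V0] at hceil
    rw [hdiv] at hlog
    push_cast
    rw [V0]
    nlinarith
  calc _ ≤ ((220 * (n : ℝ) + 3) * (m : ℝ) ^ ε) ^ n := by gcongr
    _ = _ := by
      rw [mul_pow, ← Real.rpow_mul_natCast (Nat.cast_nonneg m)]
      congr 2
      simp only [ε]; field_simp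

/-- Lemma 4: for the partition `J₁ = {1,…,s}`, `J₂ = J₃ = ∅`
(i.e. `d₁ = s`), `∑_{k₁,k₂=1}^m |Υ_{s,0,0,J,k}| ≪ m^{2(s-1)-2/5}`, with the
implied constant depending only on `s`. -/
theorem statement12 (s : ℕ) (hs : 2 ≤ s) :
    ∃ c : ℝ, 0 < c ∧ ∀ (m tm : ℕ), 1 ≤ m →
      ∀ C : Fin s → Matrix (Fin m) (Fin m) (ZMod 2),
        IsNet tm m s (fun n : Fin (2 ^ m) => netPoint m s C (n : ℕ)) →
        (tm : ℝ) ≤ Real.logb 2 m / 10 →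
        (∑ k1 ∈ Finset.Icc 1 m, ∑ k2 ∈ Finset.Icc 1 m,
            |Ups m s tm C Finset.univ ∅ ∅ k1 k2|) ≤
          c * (m : ℝ) ^ (2 * ((s : ℝ) - 1) - 2 / 5) := by
  obtain ⟨s, rfl⟩ : ∃ r, s = r + 1 := ⟨s - 1, by omega⟩
  refine ⟨2 ^ s * (220 * ((s + 2 : ℕ) : ℝ) + 3) ^ (s + 2), by positivity,
    fun m tm hm C hnet ht => ?_⟩
  have hm' : (1 : ℝ) ≤ m := by exact_mod_cast hm
  have hm0 : (0 : ℝ) < m := by linarith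
  have hs' : (1 : ℝ) ≤ s := by exact_mod_cast (show 1 ≤ s by omega)
  have htm : tm ≤ m := by
    have hL : Real.logb 2 m ≤ 2 * m := by
      rw [Real.logb, div_le_iff₀ (Real.log_pos one_lt_two)]
      nlinarith [Real.log_two_gt_d9, Real.log_le_sub_one_of_pos hm0]
    have h : (tm : ℝ) ≤ m := by linarith
    exact_mod_cast h
  have hpow : (2 : ℝ) ^ (4 * tm) ≤ (m : ℝ) ^ (2 / 5 : ℝ) := by
    calc (2 : ℝ) ^ (4 * tm) = (2 : ℝ) ^ ((4 * tm : ℕ) : ℝ) := (Real.rpow_natCast _ _).symm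
      _ ≤ (2 : ℝ) ^ (Real.logb 2 m * (2 / 5)) := by
        refine Real.rpow_le_rpow_of_exponent_le one_le_two ?_
        push_cast
        linarith
      _ = _ := by rw [Real.rpow_mul zero_le_two, Real.rpow_logb two_pos (by norm_num) hm0]
  have hlin : ((m : ℝ) + 1) ^ s ≤ 2 ^ s * (m : ℝ) ^ (s : ℝ) := by
    rw [Real.rpow_natCast, ← mul_pow]
    gcongr
    linarith
  refine (sum_abs_Ups_univ_le hnet htm).trans ?_
  calc _ ≤ (m : ℝ) ^ (2 / 5 : ℝ) * (2 ^ s * (m : ℝ) ^ (s : ℝ)) *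
          ((220 * ((s + 2 : ℕ) : ℝ) + 3) ^ (s + 2) * (m : ℝ) ^ (1 / 5 : ℝ)) := by
        gcongr
        exact polylog_factor_le hm (by omega) ht
    _ = 2 ^ s * (220 * ((s + 2 : ℕ) : ℝ) + 3) ^ (s + 2) *
          (m : ℝ) ^ ((2 / 5 : ℝ) + s + 1 / 5) := by
        rw [Real.rpow_add hm0, Real.rpow_add hm0]
        ring
    _ ≤ _ := by
        gcongr
        push_cast
        linarith
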